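/- arXiv:2410.15727 — 3 statements merged into one kernel-verified Lean document; each statement's English description precedes it below -/
import Mathlib

section
/- For every t ≥ 2 and every R ≥ √(t² − 1), the ball B(0,R) satisfies ( (1/|B(0,R)|) ∫_{B(0,R)} min(t, φ(x)) dx ) · ( (1/|B(0,R)|) ∫_{B(0,R)} min(t, φ(x))^{-1} dx ) ≤ 1 + (t − 1)²/R² ≤ 2. -/
open MeasureTheory Real Filter
open scoped ENNReal RealInnerProductSpace

noncomputable def φ (x : EuclideanSpace ℝ (Fin 2)) : ℝ := Real.sqrt (‖x‖ ^ 2 + 1)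

noncomputable def ψ (t : ℝ) (x : EuclideanSpace ℝ (Fin 2)) : ℝ :=
  φ x * (1 - Real.exp (-t / φ x))

theorem volume_real_ball_fin_two (x : EuclideanSpace ℝ (Fin 2)) {r : ℝ} (hr : 0 ≤ r) :
    volume.real (Metric.ball x r) = Real.pi * r ^ 2 := by
  rw [measureReal_def, EuclideanSpace.volume_ball_fin_two, ENNReal.toReal_mul, ENNReal.toReal_pow,
    ENNReal.toReal_ofReal hr, ENNReal.toReal_ofReal Real.pi_pos.le, mul_comm]

theorem setIntegral_ball_fun_norm_fin_two (f : ℝ → ℝ) {R : ℝ} (hR : 0 ≤ R) :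
    ∫ x in Metric.ball (0 : EuclideanSpace ℝ (Fin 2)) R, f ‖x‖ =
      2 * Real.pi * ∫ y in (0 : ℝ)..R, y * f y := by
  have hpolar := integral_fun_norm_addHaar (volume : Measure (EuclideanSpace ℝ (Fin 2)))
    ((Set.Iio R).indicator f)
  have hleft : (fun x : EuclideanSpace ℝ (Fin 2) => (Set.Iio R).indicator f ‖x‖) =
      (Metric.ball 0 R).indicator fun x => f ‖x‖ := by
    ext x
    by_cases hx : ‖x‖ < R <;> simp [hx]
  have hright : (fun y : ℝ => y ^ (2 - 1) • (Set.Iio R).indicator f y) =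
      (Set.Iio R).indicator fun y => y * f y := by
    ext y
    simp [Set.indicator_apply]
  rw [hleft, integral_indicator measurableSet_ball, finrank_euclideanSpace_fin,
    hright, setIntegral_indicator measurableSet_Iio, Set.Ioi_inter_Iio,
    volume_real_ball_fin_two 0 zero_le_one, ← integral_Ioc_eq_integral_Ioo,
    ← intervalIntegral.integral_of_le hR] at hpolar
  rw [hpolar]
  simp
  ring

theorem integral_mul_inv_min_sqrt {t R : ℝ} (ht : 1 ≤ t) (hR : √(t ^ 2 - 1) ≤ R) :
    ∫ y in (0 : ℝ)..R, y * (min t √(y ^ 2 + 1))⁻¹ = (R ^ 2 + (t - 1) ^ 2) / (2 * t) := by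
  have ht0 : 0 < t := by linarith
  have hs2 : √(t ^ 2 - 1) ^ 2 = t ^ 2 - 1 := Real.sq_sqrt (by nlinarith)
  have hs0 := Real.sqrt_nonneg (t ^ 2 - 1)
  set s := √(t ^ 2 - 1)
  have hpos (y : ℝ) : 0 < √(y ^ 2 + 1) := Real.sqrt_pos.2 (by positivity)
  have hcont : Continuous fun y : ℝ => y * (min t √(y ^ 2 + 1))⁻¹ :=
    continuous_id.mul (Continuous.inv₀ (by fun_prop) fun y => (lt_min ht0 (hpos y)).ne')
  have hinner : ∫ y in (0 : ℝ)..s, y * (min t √(y ^ 2 + 1))⁻¹ = t - 1 := by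
    rw [intervalIntegral.integral_eq_sub_of_hasDerivAt (f := fun y => √(y ^ 2 + 1)) _
      (hcont.intervalIntegrable _ _)]
    · rw [hs2, sub_add_cancel, Real.sqrt_sq ht0.le]
      simp
    · intro y hy
      rw [Set.uIcc_of_le hs0] at hy
      have hle : √(y ^ 2 + 1) ≤ t := Real.sqrt_le_iff.2 ⟨ht0.le, by nlinarith [hy.1, hy.2]⟩
      rw [min_eq_right hle]
      refine (((hasDerivAt_pow 2 y).add_const 1).sqrt (by positivity)).congr_deriv ?_
      have := (hpos y).ne'
      norm_num
      field_simp
  have houter : ∫ y in s..R, y * (min t √(y ^ 2 + 1))⁻¹ = (R ^ 2 - s ^ 2) / (2 * t) := by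
    have hEq : Set.EqOn (fun y : ℝ => y * (min t √(y ^ 2 + 1))⁻¹) (fun y => y * t⁻¹)
        (Set.uIcc s R) := by
      intro y hy
      rw [Set.uIcc_of_le hR] at hy
      have hle : t ≤ √(y ^ 2 + 1) := Real.le_sqrt_of_sq_le (by nlinarith [hy.1])
      simp [min_eq_left hle]
    rw [intervalIntegral.integral_congr hEq, intervalIntegral.integral_mul_const, integral_id]
    field_simp
  rw [← intervalIntegral.integral_add_adjacent_intervals (hcont.intervalIntegrable 0 s)
    (hcont.intervalIntegrable s R), hinner, houter, hs2]
  field_simp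
  ring

/-- For `t ≥ 2` and `R ≥ √(t² − 1)`, the `A₂`-product of averages of
`min(t, φ)` over `B(0,R)` is at most `1 + (t − 1)²/R² ≤ 2`. -/
theorem a2_product_large_ball (t R : ℝ) (ht : 2 ≤ t) (hR : Real.sqrt (t ^ 2 - 1) ≤ R) :
    ((Real.pi * R ^ 2)⁻¹ * ∫ x in Metric.ball (0 : EuclideanSpace ℝ (Fin 2)) R, min t (φ x)) *
      ((Real.pi * R ^ 2)⁻¹ *
        ∫ x in Metric.ball (0 : EuclideanSpace ℝ (Fin 2)) R, (min t (φ x))⁻¹) ≤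
      1 + (t - 1) ^ 2 / R ^ 2 ∧
    1 + (t - 1) ^ 2 / R ^ 2 ≤ 2 := by
  have ht0 : 0 < t := by linarith
  have hR0 : 0 < R := (Real.sqrt_pos.2 (by nlinarith)).trans_le hR
  have hR2 : t ^ 2 - 1 ≤ R ^ 2 := (Real.sqrt_le_left hR0.le).1 hR
  have hinv : (Real.pi * R ^ 2)⁻¹ *
      ∫ x in Metric.ball (0 : EuclideanSpace ℝ (Fin 2)) R, (min t (φ x))⁻¹ =
      t⁻¹ * (1 + (t - 1) ^ 2 / R ^ 2) := by
    simp only [φ]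
    rw [setIntegral_ball_fun_norm_fin_two (fun y => (min t √(y ^ 2 + 1))⁻¹) hR0.le,
      integral_mul_inv_min_sqrt (by linarith) hR]
    field_simp
  have hmin : (Real.pi * R ^ 2)⁻¹ *
      ∫ x in Metric.ball (0 : EuclideanSpace ℝ (Fin 2)) R, min t (φ x) ≤ t := by
    have hbound := norm_setIntegral_le_of_norm_le_const
      (μ := (volume : Measure (EuclideanSpace ℝ (Fin 2)))) (s := Metric.ball 0 R)
      (f := fun x => min t (φ x)) (C := t) measure_ball_lt_top fun x _ => by
        rw [Real.norm_of_nonneg (le_min ht0.le (show 0 ≤ φ x from Real.sqrt_nonneg _))]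
        exact min_le_left _ _
    rw [volume_real_ball_fin_two 0 hR0.le] at hbound
    rw [inv_mul_le_iff₀ (by positivity), mul_comm]
    exact (le_abs_self _).trans hbound
  constructor
  · rw [hinv]
    refine (mul_le_mul_of_nonneg_right hmin (by positivity)).trans_eq ?_
    rw [mul_inv_cancel_left₀ ht0.ne']
  · have : (t - 1) ^ 2 / R ^ 2 ≤ 1 := (div_le_one (by positivity)).2 (by nlinarith)
    linarith
end

section
/- There exists a constant C > 0 such that for every t ≥ 2 and every ball B = B(x₀,R) ⊂ ℝ² (x₀ ∈ ℝ², R > 0), one has ( (1/|B|) ∫_{B} ψ(t,x) dx ) · ( (1/|B|) ∫_{B} ψ(t,x)^{-1} dx ) ≤ C; that is, sup_{t ≥ 2} [ψ(t,·)]_{A₂} < ∞. -/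
open MeasureTheory Real Filter
open scoped ENNReal RealInnerProductSpace

lemma one_le_φ (x : EuclideanSpace ℝ (Fin 2)) : 1 ≤ φ x :=
  Real.one_le_sqrt.2 (by nlinarith [sq_nonneg ‖x‖])

lemma φ_pos (x : EuclideanSpace ℝ (Fin 2)) : 0 < φ x := one_pos.trans_le (one_le_φ x)

lemma norm_le_φ (x : EuclideanSpace ℝ (Fin 2)) : ‖x‖ ≤ φ x :=
  Real.le_sqrt_of_sq_le (by linarith)

lemma continuous_φ : Continuous φ := by
  unfold φ; fun_prop

lemma continuous_φ_inv : Continuous fun x ↦ (φ x)⁻¹ :=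
  continuous_φ.inv₀ fun x ↦ (φ_pos x).ne'

lemma φ_le_φ_add_dist (x y : EuclideanSpace ℝ (Fin 2)) : φ x ≤ φ y + dist x y := by
  have h : ‖x‖ ≤ ‖y‖ + dist x y := by
    rw [dist_eq_norm]; linarith [norm_sub_norm_le x y]
  have hy : φ y ^ 2 = ‖y‖ ^ 2 + 1 := Real.sq_sqrt (by positivity)
  refine Real.sqrt_le_iff.2 ⟨add_nonneg (φ_pos y).le dist_nonneg, ?_⟩
  nlinarith [norm_le_φ y, norm_nonneg x, norm_nonneg y, dist_nonneg (x := x) (y := y),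
    mul_le_mul_of_nonneg_right (norm_le_φ y) (dist_nonneg (x := x) (y := y))]

lemma continuous_ψ (t : ℝ) : Continuous (ψ t) := by
  unfold ψ
  exact continuous_φ.mul (continuous_const.sub
    (Real.continuous_exp.comp (continuous_const.div continuous_φ fun x ↦ (φ_pos x).ne')))

lemma ψ_pos {t : ℝ} (ht : 0 < t) (x : EuclideanSpace ℝ (Fin 2)) : 0 < ψ t x := by
  refine mul_pos (φ_pos x) (sub_pos.2 (Real.exp_lt_one_iff.2 ?_))
  exact div_neg_of_neg_of_pos (neg_lt_zero.2 ht) (φ_pos x)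

lemma ψ_le_φ (t : ℝ) (x : EuclideanSpace ℝ (Fin 2)) : ψ t x ≤ φ x :=
  mul_le_of_le_one_right (φ_pos x).le (by linarith [Real.exp_pos (-t / φ x)])

lemma ψ_le (t : ℝ) (x : EuclideanSpace ℝ (Fin 2)) : ψ t x ≤ t := by
  have h := mul_le_mul_of_nonneg_left (Real.add_one_le_exp (-t / φ x)) (φ_pos x).le
  have h' : φ x * (-t / φ x) = -t := mul_div_cancel₀ _ (φ_pos x).ne'
  unfold ψ
  linarith

lemma ψ_inv_le {t : ℝ} (ht : 0 < t) (x : EuclideanSpace ℝ (Fin 2)) :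
    (ψ t x)⁻¹ ≤ (φ x)⁻¹ + t⁻¹ := by
  have hφ := φ_pos x
  have hs : 0 < t / φ x := div_pos ht hφ
  have hexp : Real.exp (-t / φ x) ≤ (1 + t / φ x)⁻¹ := by
    rw [neg_div, Real.exp_neg]
    exact inv_anti₀ (by positivity) (by linarith [Real.add_one_le_exp (t / φ x)])
  have hlow : ((φ x)⁻¹ + t⁻¹)⁻¹ ≤ ψ t x := by
    calc ((φ x)⁻¹ + t⁻¹)⁻¹ = φ x * (1 - (1 + t / φ x)⁻¹) := by field_simp; ring
      _ ≤ ψ t x := mul_le_mul_of_nonneg_left (by linarith) hφ.le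
  exact inv_le_of_inv_le₀ (by positivity) hlow

lemma Continuous.integrableOn_metric_ball {f : EuclideanSpace ℝ (Fin 2) → ℝ} (hf : Continuous f)
    (x : EuclideanSpace ℝ (Fin 2)) (r : ℝ) : IntegrableOn f (Metric.ball x r) :=
  (hf.continuousOn.integrableOn_compact (isCompact_closedBall x r)).mono_set
    Metric.ball_subset_closedBall

lemma volume_real_ball (x : EuclideanSpace ℝ (Fin 2)) {r : ℝ} (hr : 0 ≤ r) :
    volume.real (Metric.ball x r) = π * r ^ 2 := by
  rw [Measure.real, EuclideanSpace.volume_ball_fin_two]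
  simp [ENNReal.toReal_ofReal hr, mul_comm, Real.pi_nonneg]

lemma ball_average_le_of_le {f : EuclideanSpace ℝ (Fin 2) → ℝ} (hf : Continuous f)
    {x₀ : EuclideanSpace ℝ (Fin 2)} {R c : ℝ} (hR : 0 < R)
    (h : ∀ x ∈ Metric.ball x₀ R, f x ≤ c) :
    (π * R ^ 2)⁻¹ * ∫ x in Metric.ball x₀ R, f x ≤ c := by
  have hint : ∫ x in Metric.ball x₀ R, f x ≤ ∫ _ in Metric.ball x₀ R, c :=
    setIntegral_mono_on (hf.integrableOn_metric_ball x₀ R)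
      (continuous_const.integrableOn_metric_ball x₀ R) measurableSet_ball h
  rw [setIntegral_const, volume_real_ball x₀ hR.le, smul_eq_mul] at hint
  rwa [inv_mul_le_iff₀ (by positivity)]

lemma integral_ball_zero_φ_inv_le {r : ℝ} (hr : 0 ≤ r) :
    ∫ x in Metric.ball (0 : EuclideanSpace ℝ (Fin 2)) r, (φ x)⁻¹ ≤ 2 * π * r := by
  set g : ℝ → ℝ := (Set.Iio r).indicator fun y ↦ (√(y ^ 2 + 1))⁻¹ with hg
  have hball : ∫ x in Metric.ball (0 : EuclideanSpace ℝ (Fin 2)) r, (φ x)⁻¹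
      = ∫ x : EuclideanSpace ℝ (Fin 2), g ‖x‖ := by
    rw [← integral_indicator measurableSet_ball]
    congr 1 with x
    by_cases h : ‖x‖ < r <;> simp [hg, φ, h]
  have hradial : ∫ y in Set.Ioi (0 : ℝ), y ^ (2 - 1) • g y ≤ r := by
    have hle : ∫ y in Set.Ioi (0 : ℝ), y ^ (2 - 1) • g y
        ≤ ∫ y in Set.Ioi (0 : ℝ), (Set.Iio r).indicator (fun _ ↦ (1 : ℝ)) y := by
      refine integral_mono_of_nonneg ?_ ?_ ?_
      · filter_upwards [ae_restrict_mem measurableSet_Ioi] with y hy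
        exact smul_nonneg (pow_nonneg (le_of_lt hy) _)
          (Set.indicator_nonneg (fun _ _ ↦ by positivity) _)
      · rw [integrable_indicator_iff measurableSet_Iio, IntegrableOn,
          Measure.restrict_restrict measurableSet_Iio, Set.inter_comm, Set.Ioi_inter_Iio]
        exact integrable_const _
      · filter_upwards [ae_restrict_mem measurableSet_Ioi] with y hy
        by_cases h : y < r
        · have : y ≤ √(y ^ 2 + 1) := Real.le_sqrt_of_sq_le (by linarith)
          simpa [hg, h, ← div_eq_mul_inv] using
            div_le_one_of_le₀ this (Real.sqrt_nonneg _)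
        · simp [hg, h]
    refine hle.trans_eq ?_
    rw [integral_indicator measurableSet_Iio, Measure.restrict_restrict measurableSet_Iio,
      Set.inter_comm, Set.Ioi_inter_Iio]
    simp [hr]
  rw [hball, integral_fun_norm_addHaar volume g, finrank_euclideanSpace_fin,
    volume_real_ball 0 zero_le_one, nsmul_eq_mul, smul_eq_mul]
  have := mul_le_mul_of_nonneg_left hradial (by positivity : 0 ≤ 2 * π)
  push_cast
  linarith

lemma φ_ball_averages_mul_le (x₀ : EuclideanSpace ℝ (Fin 2)) {R : ℝ} (hR : 0 < R) :
    ((π * R ^ 2)⁻¹ * ∫ x in Metric.ball x₀ R, φ x) *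
      ((π * R ^ 2)⁻¹ * ∫ x in Metric.ball x₀ R, (φ x)⁻¹) ≤ 18 := by
  have hφ := φ_pos x₀
  have hupper : (π * R ^ 2)⁻¹ * ∫ x in Metric.ball x₀ R, φ x ≤ φ x₀ + R :=
    ball_average_le_of_le continuous_φ hR fun x hx ↦ by
      linarith [φ_le_φ_add_dist x x₀, Metric.mem_ball.1 hx]
  have hnonneg : 0 ≤ (π * R ^ 2)⁻¹ * ∫ x in Metric.ball x₀ R, (φ x)⁻¹ :=
    mul_nonneg (by positivity) (integral_nonneg fun x ↦ (inv_pos.2 (φ_pos x)).le)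
  rcases le_or_gt (2 * R) (φ x₀) with h | h
  · have hinv : (π * R ^ 2)⁻¹ * ∫ x in Metric.ball x₀ R, (φ x)⁻¹ ≤ (φ x₀ / 2)⁻¹ :=
      ball_average_le_of_le continuous_φ_inv hR fun x hx ↦
        inv_anti₀ (by positivity) (by
          linarith [φ_le_φ_add_dist x₀ x, Metric.mem_ball'.1 hx])
    calc _ ≤ (φ x₀ + R) * (φ x₀ / 2)⁻¹ := mul_le_mul hupper hinv hnonneg (by positivity)
      _ ≤ 18 := by
        rw [← div_eq_mul_inv, div_le_iff₀ (by positivity)]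
        linarith
  · have hsub : Metric.ball x₀ R ⊆ Metric.ball 0 (3 * R) :=
      Metric.ball_subset_ball' (by rw [dist_zero_right]; linarith [norm_le_φ x₀])
    have hint : ∫ x in Metric.ball x₀ R, (φ x)⁻¹ ≤ 2 * π * (3 * R) :=
      (setIntegral_mono_set (continuous_φ_inv.integrableOn_metric_ball 0 (3 * R))
        (.of_forall fun x ↦ (inv_pos.2 (φ_pos x)).le) hsub.eventuallyLE).trans
        (integral_ball_zero_φ_inv_le (by positivity))
    have hinv : (π * R ^ 2)⁻¹ * ∫ x in Metric.ball x₀ R, (φ x)⁻¹ ≤ 6 / R :=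
      (mul_le_mul_of_nonneg_left hint (by positivity)).trans_eq (by field_simp; norm_num)
    calc _ ≤ (3 * R) * (6 / R) :=
          mul_le_mul (hupper.trans (by linarith)) hinv hnonneg (by positivity)
      _ = 18 := by field_simp; norm_num

/-- Uniform `A₂`-bound for the weight `ψ(t,·)`: there is `C > 0` such that for every
`t ≥ 2` and every ball `B(x₀,R) ⊂ ℝ²`, the product of the averages of `ψ(t,·)` and of
`ψ(t,·)⁻¹` is at most `C`; i.e. `sup_{t ≥ 2} [ψ(t,·)]_{A₂} < ∞`. -/
theorem psi_A2_uniform :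
    ∃ C > 0, ∀ t : ℝ, 2 ≤ t → ∀ x₀ : EuclideanSpace ℝ (Fin 2), ∀ R : ℝ, 0 < R →
      ((Real.pi * R ^ 2)⁻¹ * ∫ x in Metric.ball x₀ R, ψ t x) *
        ((Real.pi * R ^ 2)⁻¹ * ∫ x in Metric.ball x₀ R, (ψ t x)⁻¹) ≤ C := by
  refine ⟨19, by norm_num, fun t ht x₀ R hR ↦ ?_⟩
  have ht0 : 0 < t := by linarith
  set a : ℝ := (π * R ^ 2)⁻¹ with ha
  have ha0 : 0 < a := by positivity
  have hψt : a * ∫ x in Metric.ball x₀ R, ψ t x ≤ t :=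
    ball_average_le_of_le (continuous_ψ t) hR fun x _ ↦ ψ_le t x
  have hψφ : a * ∫ x in Metric.ball x₀ R, ψ t x ≤ a * ∫ x in Metric.ball x₀ R, φ x :=
    mul_le_mul_of_nonneg_left (setIntegral_mono ((continuous_ψ t).integrableOn_metric_ball x₀ R)
      (continuous_φ.integrableOn_metric_ball x₀ R) (ψ_le_φ t)) ha0.le
  have hψ0 : 0 ≤ a * ∫ x in Metric.ball x₀ R, ψ t x :=
    mul_nonneg ha0.le (integral_nonneg fun x ↦ (ψ_pos ht0 x).le)
  have hφ0 : 0 ≤ a * ∫ x in Metric.ball x₀ R, (φ x)⁻¹ :=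
    mul_nonneg ha0.le (integral_nonneg fun x ↦ (inv_pos.2 (φ_pos x)).le)
  have hinv : a * ∫ x in Metric.ball x₀ R, (ψ t x)⁻¹
      ≤ a * (∫ x in Metric.ball x₀ R, (φ x)⁻¹) + t⁻¹ := by
    have hle : ∫ x in Metric.ball x₀ R, (ψ t x)⁻¹
        ≤ ∫ x in Metric.ball x₀ R, ((φ x)⁻¹ + t⁻¹) :=
      setIntegral_mono
        (((continuous_ψ t).inv₀ fun x ↦ (ψ_pos ht0 x).ne').integrableOn_metric_ball x₀ R)
        ((continuous_φ_inv.add continuous_const).integrableOn_metric_ball x₀ R)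
        (ψ_inv_le ht0)
    rw [integral_add (continuous_φ_inv.integrableOn_metric_ball x₀ R)
      (continuous_const.integrableOn_metric_ball x₀ R)] at hle
    have hconst : a * ∫ _ in Metric.ball x₀ R, t⁻¹ ≤ t⁻¹ :=
      ball_average_le_of_le continuous_const hR fun _ _ ↦ le_rfl
    have := mul_le_mul_of_nonneg_left hle ha0.le
    linarith
  calc _ ≤ (a * ∫ x in Metric.ball x₀ R, ψ t x) *
        (a * (∫ x in Metric.ball x₀ R, (φ x)⁻¹) + t⁻¹) := mul_le_mul_of_nonneg_left hinv hψ0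
    _ = (a * ∫ x in Metric.ball x₀ R, ψ t x) * (a * ∫ x in Metric.ball x₀ R, (φ x)⁻¹) +
        (a * ∫ x in Metric.ball x₀ R, ψ t x) * t⁻¹ := by ring
    _ ≤ 18 + t * t⁻¹ := add_le_add
        ((mul_le_mul_of_nonneg_right hψφ hφ0).trans (φ_ball_averages_mul_le x₀ hR))
        (mul_le_mul_of_nonneg_right hψt (inv_pos.2 ht0).le)
    _ = 19 := by rw [mul_inv_cancel₀ ht0.ne']; norm_num
end

section
/- There exists a constant C > 0 such that for every t > 0 and every smooth compactly supported vector field u : ℝ² → ℝ² with div u = 0, letting w := ∂₁u₂ − ∂₂u₁ denote its vorticity, one has ( ∫_{ℝ²} ψ(t,x)² |∇²u(x)|² dx )^{1/2} ≤ C [ ( ∫_{ℝ²} |∇u(x)|² dx )^{1/2} + ( ∫_{ℝ²} ψ(t,x)² |∇w(x)|² dx )^{1/2} ]. -/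
open MeasureTheory Real Filter
open scoped ENNReal RealInnerProductSpace

/-- The partial derivative `∂ᵢ f` of a scalar function on `ℝ²`. -/
noncomputable def pd (i : Fin 2) (f : EuclideanSpace ℝ (Fin 2) → ℝ)
    (x : EuclideanSpace ℝ (Fin 2)) : ℝ :=
  fderiv ℝ f x (EuclideanSpace.single i 1)

lemma ContDiff.pd {f : EuclideanSpace ℝ (Fin 2) → ℝ} (hf : ContDiff ℝ (⊤ : ℕ∞) f) (i : Fin 2) :
    ContDiff ℝ (⊤ : ℕ∞) (pd i f) :=
  (hf.fderiv_right (m := (⊤ : ℕ∞)) (by simp)).clm_apply contDiff_const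

lemma HasCompactSupport.pd {f : EuclideanSpace ℝ (Fin 2) → ℝ} (hf : HasCompactSupport f)
    (i : Fin 2) : HasCompactSupport (pd i f) :=
  hf.fderiv_apply ℝ _

lemma pd_mul {f g : EuclideanSpace ℝ (Fin 2) → ℝ} (hf : Differentiable ℝ f)
    (hg : Differentiable ℝ g) (i : Fin 2) (x : EuclideanSpace ℝ (Fin 2)) :
    pd i (fun y => f y * g y) x = pd i f x * g x + f x * pd i g x := by
  unfold pd
  rw [fderiv_fun_mul (hf x) (hg x)]
  simp
  ring

lemma pd_add {f g : EuclideanSpace ℝ (Fin 2) → ℝ} (hf : Differentiable ℝ f)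
    (hg : Differentiable ℝ g) (i : Fin 2) (x : EuclideanSpace ℝ (Fin 2)) :
    pd i (fun y => f y + g y) x = pd i f x + pd i g x := by
  unfold pd
  rw [fderiv_fun_add (hf x) (hg x)]
  simp

lemma pd_sub {f g : EuclideanSpace ℝ (Fin 2) → ℝ} (hf : Differentiable ℝ f)
    (hg : Differentiable ℝ g) (i : Fin 2) (x : EuclideanSpace ℝ (Fin 2)) :
    pd i (fun y => f y - g y) x = pd i f x - pd i g x := by
  unfold pd
  rw [fderiv_fun_sub (hf x) (hg x)]
  simp

lemma pd_comm {f : EuclideanSpace ℝ (Fin 2) → ℝ} (hf : ContDiff ℝ (⊤ : ℕ∞) f) (i j : Fin 2)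
    (x : EuclideanSpace ℝ (Fin 2)) : pd i (pd j f) x = pd j (pd i f) x := by
  have hd : DifferentiableAt ℝ (fderiv ℝ f) x :=
    ((hf.fderiv_right (m := (⊤ : ℕ∞)) (by simp)).differentiable (by simp)) x
  have key (k l : Fin 2) : pd k (pd l f) x =
      fderiv ℝ (fderiv ℝ f) x (EuclideanSpace.single k 1) (EuclideanSpace.single l 1) := by
    change fderiv ℝ (fun y => fderiv ℝ f y (EuclideanSpace.single l 1)) x _ = _
    rw [fderiv_clm_apply hd (differentiableAt_const _)]
    simp
  rw [key, key]
  exact (hf.contDiffAt.isSymmSndFDerivAt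
    (by simpa using WithTop.coe_le_coe.2 (le_top : (2 : ℕ∞) ≤ ⊤))) _ _

lemma integral_pd_eq_zero {f : EuclideanSpace ℝ (Fin 2) → ℝ} (hf : ContDiff ℝ (⊤ : ℕ∞) f)
    (hc : HasCompactSupport f) (i : Fin 2) : ∫ x, pd i f x = 0 := by
  have h := integral_mul_fderiv_eq_neg_fderiv_mul_of_integrable (𝕜 := ℝ)
    (μ := (volume : Measure (EuclideanSpace ℝ (Fin 2)))) (f := fun _ => (1 : ℝ)) (g := f)
    (v := EuclideanSpace.single i 1) (by simp)
    (by
      simp only [one_mul]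
      exact (hf.pd i).continuous.integrable_of_hasCompactSupport (hc.pd i))
    (by simpa using hf.continuous.integrable_of_hasCompactSupport hc)
    (by fun_prop) (fun x _ => hf.differentiable (by simp) x)
  simpa [pd] using h

lemma contDiff_φ : ContDiff ℝ (⊤ : ℕ∞) φ :=
  ((contDiff_norm_sq ℝ).add contDiff_const).sqrt fun x => by positivity

lemma contDiff_ψ (t : ℝ) : ContDiff ℝ (⊤ : ℕ∞) (ψ t) :=
  contDiff_φ.mul (contDiff_const.sub
    (contDiff_const.div contDiff_φ fun x => (φ_pos x).ne').exp)

lemma abs_pd_φ_le_one (i : Fin 2) (x : EuclideanSpace ℝ (Fin 2)) : |pd i φ x| ≤ 1 := by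
  have h : HasFDerivAt φ _ x :=
    (((hasStrictFDerivAt_norm_sq x).hasFDerivAt).add_const 1).sqrt (by positivity)
  have hφ := φ_pos x
  have hi : |x i| ≤ φ x := by
    refine Real.abs_le_sqrt ?_
    rw [EuclideanSpace.real_norm_sq_eq, Fin.sum_univ_two]
    fin_cases i <;> simp <;> linarith [sq_nonneg (x 0), sq_nonneg (x 1)]
  have hp : pd i φ x = x i / φ x := by
    unfold pd
    rw [h.fderiv]
    simp only [φ] at hφ ⊢
    simp [EuclideanSpace.inner_single_right]
    field_simp
  rw [hp, abs_div, abs_of_pos hφ]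
  exact div_le_one_of_le₀ hi hφ.le

lemma abs_pd_ψ_le_one {t : ℝ} (ht : 0 < t) (i : Fin 2) (x : EuclideanSpace ℝ (Fin 2)) :
    |pd i (ψ t) x| ≤ 1 := by
  have hφ := φ_pos x
  have hg : HasDerivAt (fun s : ℝ => s * (1 - Real.exp (-t / s)))
      (1 - (1 + t / φ x) * Real.exp (-(t / φ x))) (φ x) := by
    have h1 : HasDerivAt (fun s : ℝ => -t / s) (t / φ x ^ 2) (φ x) := by
      refine ((hasDerivAt_const (φ x) (-t)).div (hasDerivAt_id (φ x)) hφ.ne').congr_deriv ?_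
      simp
    refine ((hasDerivAt_id (φ x)).mul ((h1.exp).const_sub 1)).congr_deriv ?_
    simp only [id, neg_div]
    field_simp
    ring
  have h := hg.comp_hasFDerivAt x (contDiff_φ.differentiable (by simp) x).hasFDerivAt
  have hp : pd i (ψ t) x = (1 - (1 + t / φ x) * Real.exp (-(t / φ x))) * pd i φ x := by
    have h' : HasFDerivAt (ψ t) _ x := h
    unfold pd
    rw [h'.fderiv]
    simp
  rw [hp, abs_mul]
  refine mul_le_one₀ ?_ (abs_nonneg _) (abs_pd_φ_le_one i x)
  have ha : 0 < t / φ x := by positivity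
  have he : (1 + t / φ x) * Real.exp (-(t / φ x)) ≤ 1 := by
    rw [Real.exp_neg, ← div_eq_mul_inv, div_le_one (Real.exp_pos _)]
    linarith [Real.add_one_le_exp (t / φ x)]
  have h0 : 0 ≤ (1 + t / φ x) * Real.exp (-(t / φ x)) := by positivity
  rw [abs_le]
  constructor <;> linarith

/-- The weighted Hessian determinant in divergence form, up to first-order terms. -/
noncomputable def hessDiv (r f : EuclideanSpace ℝ (Fin 2) → ℝ) (x : EuclideanSpace ℝ (Fin 2)) :
    ℝ :=
  pd 0 (fun y => r y * r y * (pd 0 f y * pd 1 (pd 1 f) y)) x -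
    pd 1 (fun y => r y * r y * (pd 0 f y * pd 0 (pd 1 f) y)) x

lemma hessDiv_eq {r f : EuclideanSpace ℝ (Fin 2) → ℝ} (hr : ContDiff ℝ (⊤ : ℕ∞) r)
    (hf : ContDiff ℝ (⊤ : ℕ∞) f) (x : EuclideanSpace ℝ (Fin 2)) :
    hessDiv r f x = r x ^ 2 * (pd 0 (pd 0 f) x * pd 1 (pd 1 f) x - pd 0 (pd 1 f) x ^ 2) +
      2 * r x * pd 0 r x * pd 0 f x * pd 1 (pd 1 f) x -
      2 * r x * pd 1 r x * pd 0 f x * pd 0 (pd 1 f) x := by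
  have d {g : EuclideanSpace ℝ (Fin 2) → ℝ} (hg : ContDiff ℝ (⊤ : ℕ∞) g) : Differentiable ℝ g :=
    hg.differentiable (by simp)
  have hf0 := hf.pd 0
  have hf11 := (hf.pd 1).pd 1
  have hf01 := (hf.pd 1).pd 0
  unfold hessDiv
  rw [pd_mul (d (hr.mul hr)) (d (hf0.mul hf11)), pd_mul (d (hr.mul hr)) (d (hf0.mul hf01)),
    pd_mul (d hr) (d hr), pd_mul (d hr) (d hr), pd_mul (d hf0) (d hf11), pd_mul (d hf0) (d hf01),
    pd_comm (hf.pd 1) 1 0, pd_comm hf 1 0]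
  ring

lemma integrable_hessDiv {r f : EuclideanSpace ℝ (Fin 2) → ℝ} (hr : ContDiff ℝ (⊤ : ℕ∞) r)
    (hf : ContDiff ℝ (⊤ : ℕ∞) f) (hc : HasCompactSupport f) :
    Integrable (hessDiv r f) ∧ ∫ x, hessDiv r f x = 0 := by
  have hs (g : EuclideanSpace ℝ (Fin 2) → ℝ) (hg : ContDiff ℝ (⊤ : ℕ∞) g) :
      ContDiff ℝ (⊤ : ℕ∞) (fun y => r y * r y * (pd 0 f y * g y)) :=
    (hr.mul hr).mul ((hf.pd 0).mul hg)
  have hcs (g : EuclideanSpace ℝ (Fin 2) → ℝ) :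
      HasCompactSupport (fun y => r y * r y * (pd 0 f y * g y)) :=
    ((hc.pd 0).mul_right (f' := g)).mul_left (f := fun y => r y * r y)
  have hi (i : Fin 2) (g : EuclideanSpace ℝ (Fin 2) → ℝ) (hg : ContDiff ℝ (⊤ : ℕ∞) g) :
      Integrable (pd i (fun y => r y * r y * (pd 0 f y * g y))) :=
    ((hs g hg).pd i).continuous.integrable_of_hasCompactSupport ((hcs g).pd i)
  have h11 := (hf.pd 1).pd 1
  have h01 := (hf.pd 1).pd 0
  refine ⟨(hi 0 _ h11).sub (hi 1 _ h01), ?_⟩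
  unfold hessDiv
  rw [integral_sub (hi 0 _ h11) (hi 1 _ h01), integral_pd_eq_zero (hs _ h11) (hcs _),
    integral_pd_eq_zero (hs _ h01) (hcs _), sub_zero]

lemma sq_mul_hessian_le {r f : EuclideanSpace ℝ (Fin 2) → ℝ} (hr : ContDiff ℝ (⊤ : ℕ∞) r)
    (hf : ContDiff ℝ (⊤ : ℕ∞) f) (x : EuclideanSpace ℝ (Fin 2)) (h : ∀ i, |pd i r x| ≤ 1) :
    r x ^ 2 * ∑ i : Fin 2, ∑ j : Fin 2, pd i (pd j f) x ^ 2 ≤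
      2 * (r x ^ 2 * (pd 0 (pd 0 f) x + pd 1 (pd 1 f) x) ^ 2) + 32 * pd 0 f x ^ 2 -
        4 * hessDiv r f x := by
  rw [hessDiv_eq hr hf]
  simp only [Fin.sum_univ_two]
  rw [pd_comm hf 1 0]
  have young (c a b s : ℝ) (hc : |c| ≤ 1) : 8 * (s * c * a * b) ≤ s ^ 2 * b ^ 2 + 16 * a ^ 2 := by
    have hc2 : c ^ 2 ≤ 1 := (sq_le_one_iff_abs_le_one c).2 hc
    nlinarith [sq_nonneg (s * b - 4 * c * a), mul_le_mul_of_nonneg_right hc2 (sq_nonneg a)]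
  have h0 := young (pd 0 r x) (pd 0 f x) (pd 1 (pd 1 f) x) (r x) (h 0)
  have h1 := young (-pd 1 r x) (pd 0 f x) (pd 0 (pd 1 f) x) (r x) (by simpa using h 1)
  have h2 : 0 ≤ r x ^ 2 * pd 0 (pd 0 f) x ^ 2 := by positivity
  have h3 : 0 ≤ r x ^ 2 * pd 0 (pd 1 f) x ^ 2 := by positivity
  nlinarith

/-- Weighted estimate for second derivatives: there is `C > 0` such that for every
`t > 0` and every smooth, compactly supported, divergence-free `u : ℝ² → ℝ²` with
vorticity `w = ∂₁u₂ − ∂₂u₁`,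
`(∫ ψ(t,·)²|∇²u|²)^{1/2} ≤ C[(∫ |∇u|²)^{1/2} + (∫ ψ(t,·)²|∇w|²)^{1/2}]`. -/
theorem weighted_second_derivative_estimate :
    ∃ C > 0, ∀ t : ℝ, 0 < t →
      ∀ u : EuclideanSpace ℝ (Fin 2) → EuclideanSpace ℝ (Fin 2),
        ContDiff ℝ (⊤ : ℕ∞) u → HasCompactSupport u →
        (∀ x, pd 0 (fun y => u y 0) x + pd 1 (fun y => u y 1) x = 0) →
        Real.sqrt (∫ x, ψ t x ^ 2 * ∑ i : Fin 2, ∑ j : Fin 2, ∑ k : Fin 2,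
            pd i (pd j (fun y => u y k)) x ^ 2) ≤
          C * (Real.sqrt (∫ x, ∑ i : Fin 2, ∑ j : Fin 2, pd i (fun y => u y j) x ^ 2) +
            Real.sqrt (∫ x, ψ t x ^ 2 * ∑ i : Fin 2,
              pd i (fun y => pd 0 (fun z => u z 1) y - pd 1 (fun z => u z 0) y) x ^ 2)) := by
  refine ⟨6, by norm_num, fun t ht u hu hc hdiv => ?_⟩
  have hk (k : Fin 2) : ContDiff ℝ (⊤ : ℕ∞) (fun y => u y k) := by fun_prop
  have hck (k : Fin 2) : HasCompactSupport (fun y => u y k) :=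
    hc.comp_left (g := fun v : EuclideanSpace ℝ (Fin 2) => v k) rfl
  have hψ := contDiff_ψ t
  have hcc {f : EuclideanSpace ℝ (Fin 2) → ℝ} (hf : ContDiff ℝ (⊤ : ℕ∞) f)
      (hcf : HasCompactSupport f) : Integrable fun x => f x ^ 2 := by
    simp only [pow_two]
    exact (hf.mul hf).continuous.integrable_of_hasCompactSupport hcf.mul_right
  have hwc {f : EuclideanSpace ℝ (Fin 2) → ℝ} (hf : ContDiff ℝ (⊤ : ℕ∞) f)
      (hcf : HasCompactSupport f) : Integrable fun x => ψ t x ^ 2 * f x ^ 2 := by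
    simp only [← mul_pow]
    exact hcc (hψ.mul hf) hcf.mul_left
  have hω : ContDiff ℝ (⊤ : ℕ∞) (fun y => pd 0 (fun z => u z 1) y - pd 1 (fun z => u z 0) y) :=
    ((hk 1).pd 0).sub ((hk 0).pd 1)
  have hcω : HasCompactSupport (fun y => pd 0 (fun z => u z 1) y - pd 1 (fun z => u z 0) y) :=
    ((hck 1).pd 0).sub ((hck 0).pd 1)
  have dk (i k : Fin 2) : Differentiable ℝ (pd i (fun y => u y k)) :=
    ((hk k).pd i).differentiable (by simp)
  have hdiv' (i : Fin 2) (x : EuclideanSpace ℝ (Fin 2)) :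
      pd i (pd 0 (fun y => u y 0)) x + pd i (pd 1 (fun y => u y 1)) x = 0 := by
    rw [← pd_add (dk 0 0) (dk 1 1)]
    simp only [hdiv]
    simp [pd]
  have hΔ0 (x : EuclideanSpace ℝ (Fin 2)) :
      pd 0 (pd 0 (fun y => u y 0)) x + pd 1 (pd 1 (fun y => u y 0)) x =
        -pd 1 (fun y => pd 0 (fun z => u z 1) y - pd 1 (fun z => u z 0) y) x := by
    rw [pd_sub (dk 0 1) (dk 1 0), pd_comm (hk 1) 1 0]
    linarith [hdiv' 0 x]
  have hΔ1 (x : EuclideanSpace ℝ (Fin 2)) :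
      pd 0 (pd 0 (fun y => u y 1)) x + pd 1 (pd 1 (fun y => u y 1)) x =
        pd 0 (fun y => pd 0 (fun z => u z 1) y - pd 1 (fun z => u z 0) y) x := by
    rw [pd_sub (dk 0 1) (dk 1 0), pd_comm (hk 0) 0 1]
    linarith [hdiv' 1 x]
  set ω := fun y => pd 0 (fun z => u z 1) y - pd 1 (fun z => u z 0) y
  obtain ⟨hD0, hI0⟩ := integrable_hessDiv hψ (hk 0) (hck 0)
  obtain ⟨hD1, hI1⟩ := integrable_hessDiv hψ (hk 1) (hck 1)
  have hA : Integrable fun x => ∑ i : Fin 2, ∑ j : Fin 2, pd i (fun y => u y j) x ^ 2 :=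
    integrable_finsetSum _ fun i _ => integrable_finsetSum _ fun j _ =>
      hcc ((hk j).pd i) ((hck j).pd i)
  have hB : Integrable fun x => ψ t x ^ 2 * ∑ i : Fin 2, pd i ω x ^ 2 := by
    simp only [Finset.mul_sum]
    exact integrable_finsetSum _ fun i _ => hwc (hω.pd i) (hcω.pd i)
  have hL : Integrable fun x => ψ t x ^ 2 * ∑ i : Fin 2, ∑ j : Fin 2, ∑ k : Fin 2,
      pd i (pd j (fun y => u y k)) x ^ 2 := by
    simp only [Finset.mul_sum]
    exact integrable_finsetSum _ fun i _ => integrable_finsetSum _ fun j _ =>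
      integrable_finsetSum _ fun k _ => hwc (((hk k).pd j).pd i) (((hck k).pd j).pd i)
  have hD := hD0.add hD1
  have hmain := integral_mono hL (((hB.const_mul 2).add (hA.const_mul 32)).sub (hD.const_mul 4))
    (fun x => by
      have e0 := sq_mul_hessian_le hψ (hk 0) x fun i => abs_pd_ψ_le_one ht i x
      have e1 := sq_mul_hessian_le hψ (hk 1) x fun i => abs_pd_ψ_le_one ht i x
      rw [hΔ0] at e0
      rw [hΔ1] at e1
      simp only [Fin.sum_univ_two, Pi.add_apply, Pi.sub_apply] at e0 e1 ⊢
      linarith [sq_nonneg (pd 1 (fun y => u y 0) x), sq_nonneg (pd 1 (fun y => u y 1) x)])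
  rw [integral_sub' ((hB.const_mul 2).add (hA.const_mul 32)) (hD.const_mul 4),
    integral_add' (hB.const_mul 2) (hA.const_mul 32), integral_const_mul, integral_const_mul,
    integral_const_mul, integral_add' hD0 hD1, hI0, hI1] at hmain
  have hA0 : 0 ≤ ∫ x, ∑ i : Fin 2, ∑ j : Fin 2, pd i (fun y => u y j) x ^ 2 :=
    integral_nonneg fun x => by positivity
  have hB0 : 0 ≤ ∫ x, ψ t x ^ 2 * ∑ i : Fin 2, pd i ω x ^ 2 :=
    integral_nonneg fun x => by positivity
  refine Real.sqrt_le_iff.2 ⟨by positivity, hmain.trans ?_⟩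
  have sA := Real.sq_sqrt hA0
  have sB := Real.sq_sqrt hB0
  have pAB := mul_nonneg (Real.sqrt_nonneg
    (∫ x, ∑ i : Fin 2, ∑ j : Fin 2, pd i (fun y => u y j) x ^ 2))
    (Real.sqrt_nonneg (∫ x, ψ t x ^ 2 * ∑ i : Fin 2, pd i ω x ^ 2))
  rw [mul_pow, add_sq, sA, sB]
  linarith
end
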